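/- Let p > 3 be prime. The number of regular subgroups G of Hol(M₁) with G isomorphic to M₁ and |Θ(G)| = p equals (p³ − p² − 1)(p + 1), and the number of regular subgroups G of Hol(M₁) with G elementary abelian of order p³ and |Θ(G)| = p equals (p + 1)p². -/

import Mathlib

/-! ## The Heisenberg group of order `p³` -/

@[ext]
structure Heisenberg (p : ℕ) where
  x : ZMod p
  y : ZMod p
  z : ZMod p

namespace Heisenberg

variable {p : ℕ}

instance : Mul (Heisenberg p) :=
  ⟨fun g h => ⟨g.x + h.x, g.y + h.y, g.z + h.z + h.x * g.y⟩⟩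

instance : One (Heisenberg p) := ⟨⟨0, 0, 0⟩⟩

instance : Inv (Heisenberg p) := ⟨fun g => ⟨-g.x, -g.y, -g.z + g.x * g.y⟩⟩

@[simp] theorem mul_x (g h : Heisenberg p) : (g * h).x = g.x + h.x := rfl
@[simp] theorem mul_y (g h : Heisenberg p) : (g * h).y = g.y + h.y := rfl
@[simp] theorem mul_z (g h : Heisenberg p) : (g * h).z = g.z + h.z + h.x * g.y := rfl
@[simp] theorem one_x : (1 : Heisenberg p).x = 0 := rfl
@[simp] theorem one_y : (1 : Heisenberg p).y = 0 := rfl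
@[simp] theorem one_z : (1 : Heisenberg p).z = 0 := rfl
@[simp] theorem inv_x (g : Heisenberg p) : (g⁻¹).x = -g.x := rfl
@[simp] theorem inv_y (g : Heisenberg p) : (g⁻¹).y = -g.y := rfl
@[simp] theorem inv_z (g : Heisenberg p) : (g⁻¹).z = -g.z + g.x * g.y := rfl

instance : Group (Heisenberg p) where
  mul_assoc a b c := by ext <;> simp <;> ring
  one_mul a := by ext <;> simp
  mul_one a := by ext <;> simp
  inv_mul_cancel a := by ext <;> simp <;> ring

/-- The generator `ρ` (a generator of the centre). -/
def ρ : Heisenberg p := ⟨0, 0, 1⟩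

/-- The generator `σ`. -/
def σ : Heisenberg p := ⟨1, 0, 0⟩

/-- The generator `τ`. -/
def τ : Heisenberg p := ⟨0, 1, 0⟩

/-- The automorphism `α₁` determined by `σ ↦ ρσ`, `τ ↦ τ` (and `ρ ↦ ρ`). -/
def α₁ : MulAut (Heisenberg p) where
  toFun g := ⟨g.x, g.y, g.z + g.x⟩
  invFun g := ⟨g.x, g.y, g.z - g.x⟩
  left_inv g := by ext <;> simp
  right_inv g := by ext <;> simp
  map_mul' g h := by ext <;> simp <;> ring

/-- The automorphism `α₃` determined by `σ ↦ σ`, `τ ↦ ρτ` (and `ρ ↦ ρ`). -/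
def α₃ : MulAut (Heisenberg p) where
  toFun g := ⟨g.x, g.y, g.z + g.y⟩
  invFun g := ⟨g.x, g.y, g.z - g.y⟩
  left_inv g := by ext <;> simp
  right_inv g := by ext <;> simp
  map_mul' g h := by ext <;> simp <;> ring

/-- The automorphism `α₂` determined by `σ ↦ στ`, `τ ↦ τ` (and `ρ ↦ ρ`), for `p` an odd
prime. -/
def α₂ (p : ℕ) [Fact p.Prime] (hp : p ≠ 2) : MulAut (Heisenberg p) where
  toFun g := ⟨g.x, g.x + g.y, g.z + g.x * (g.x - 1) / 2⟩
  invFun g := ⟨g.x, g.y - g.x, g.z - g.x * (g.x - 1) / 2⟩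
  left_inv g := by ext <;> simp <;> ring
  right_inv g := by ext <;> simp <;> ring
  map_mul' g h := by
    have h2 : (2 : ZMod p) ≠ 0 := by
      intro h
      have h' : ((2 : ℕ) : ZMod p) = 0 := by exact_mod_cast h
      rw [CharP.cast_eq_zero_iff (ZMod p) p 2] at h'
      have h1 := Nat.le_of_dvd (by norm_num) h'
      have h2 := (Fact.out : p.Prime).two_le
      omega
    ext <;> simp
    · ring
    · field_simp
      ring

end Heisenberg

open Heisenberg

/-! ## The holomorph of `M₁` inside the permutation group -/

/-- The left regular representation `M₁ → Perm M₁`. -/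
def leftMulHom (p : ℕ) : Heisenberg p →* Equiv.Perm (Heisenberg p) :=
  MulAction.toPermHom (Heisenberg p) (Heisenberg p)

/-- The holomorph of `M₁`, realized as the subgroup of `Perm M₁` generated by left
translations and automorphisms of `M₁`. -/
def Hol (p : ℕ) : Subgroup (Equiv.Perm (Heisenberg p)) :=
  (leftMulHom p).range ⊔
    (MulAut.toPerm (Heisenberg p)).range

/-- A subgroup of `Perm X` is regular if it acts freely and transitively on `X`. -/
def IsRegularSub {X : Type*} (H : Subgroup (Equiv.Perm X)) : Prop :=
  ∀ x y : X, ∃! g : Equiv.Perm X, g ∈ H ∧ g x = y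

/-- The canonical projection `Θ : Hol(M₁) → Aut(M₁)` (with kernel the left translations),
written as a function on permutations: it sends `π` to `m ↦ (π 1)⁻¹ * π m`; on elements of the
holomorph, this is exactly the automorphism component. -/
def theta (p : ℕ) (π : Equiv.Perm (Heisenberg p)) : Equiv.Perm (Heisenberg p) :=
  (Equiv.mulLeft (π 1))⁻¹ * π

/-- The cardinality of the image `Θ(G)` of a subgroup `G` of the holomorph under the canonical
projection `Θ`. -/
noncomputable def thetaCard (p : ℕ) (G : Subgroup (Equiv.Perm (Heisenberg p))) : ℕ :=
  Nat.card (theta p '' (G : Set (Equiv.Perm (Heisenberg p))))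

/-- The conjugation action of `Aut(M₁)` (viewed inside `Perm M₁`) on subgroups of `Perm M₁`. -/
def autConj (p : ℕ) (α : MulAut (Heisenberg p)) (G : Subgroup (Equiv.Perm (Heisenberg p))) :
    Subgroup (Equiv.Perm (Heisenberg p)) :=
  Subgroup.map (MulAut.conj (MulAut.toPerm (Heisenberg p) α)).toMonoidHom G


/-- `G` is a regular subgroup of `Hol(M₁)` isomorphic to `M₁` whose image under the canonical
projection `Θ : Hol(M₁) → Aut(M₁)` has cardinality `r`. -/
def condM1 (p r : ℕ) (G : Subgroup (Equiv.Perm (Heisenberg p))) : Prop :=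
  G ≤ Hol p ∧ IsRegularSub G ∧ thetaCard p G = r ∧ Nonempty (G ≃* Heisenberg p)

/-- `G` is a regular subgroup of `Hol(M₁)`, elementary abelian of order `p³`, whose image under
the canonical projection `Θ : Hol(M₁) → Aut(M₁)` has cardinality `r`. -/
def condEA (p r : ℕ) (G : Subgroup (Equiv.Perm (Heisenberg p))) : Prop :=
  G ≤ Hol p ∧ IsRegularSub G ∧ thetaCard p G = r ∧
    Nonempty (G ≃* Multiplicative (ZMod p × ZMod p × ZMod p))


namespace Heisenberg

variable {p : ℕ}

theorem leftMulHom_apply (g h : Heisenberg p) : leftMulHom p g h = g * h := rfl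

/-- The permutations of `M₁` that preserve the ternary operation `a b⁻¹ c`. -/
def heapAut (p : ℕ) : Subgroup (Equiv.Perm (Heisenberg p)) where
  carrier := {π | ∀ a b c, π (a * b⁻¹ * c) = π a * (π b)⁻¹ * π c}
  mul_mem' {π π'} hπ hπ' a b c := by
    simp only [Equiv.Perm.mul_apply]
    rw [hπ', hπ]
  one_mem' _ _ _ := rfl
  inv_mem' {π} hπ a b c := by
    rw [Equiv.Perm.inv_eq_iff_eq, hπ]
    simp

theorem toPerm_apply (α : MulAut (Heisenberg p)) (g : Heisenberg p) :
    MulAut.toPerm (Heisenberg p) α g = α g := rfl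

theorem Hol_le_heapAut : Hol p ≤ heapAut p := by
  refine sup_le ?_ ?_
  · rintro _ ⟨m, rfl⟩ a b c
    simp [leftMulHom, mul_assoc]
  · rintro _ ⟨α, rfl⟩ a b c
    simp [toPerm_apply]

theorem theta_apply (π : Equiv.Perm (Heisenberg p)) (g : Heisenberg p) :
    theta p π g = (π 1)⁻¹ * π g := rfl

theorem theta_mul {π : Equiv.Perm (Heisenberg p)} (hπ : π ∈ heapAut p)
    (π' : Equiv.Perm (Heisenberg p)) : theta p (π * π') = theta p π * theta p π' := by
  ext1 g
  have h := hπ 1 (π' 1) (π' g)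
  simp only [Equiv.Perm.mul_apply, theta_apply]
  rw [one_mul] at h
  rw [h]
  group

theorem theta_map_mul {π : Equiv.Perm (Heisenberg p)} (hπ : π ∈ heapAut p)
    (g h : Heisenberg p) : theta p π (g * h) = theta p π g * theta p π h := by
  have := hπ g 1 h
  rw [inv_one, mul_one] at this
  simp only [theta_apply, this]
  group

/-- The restriction of `theta` to a subgroup of the holomorph, as a homomorphism. -/
def thetaHom (G : Subgroup (Equiv.Perm (Heisenberg p))) (hG : G ≤ Hol p) :
    G →* Equiv.Perm (Heisenberg p) :=
  MonoidHom.mk' (fun π => theta p π) fun π π' =>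
    theta_mul (Hol_le_heapAut (hG π.2)) π'

theorem card_range_thetaHom (G : Subgroup (Equiv.Perm (Heisenberg p))) (hG : G ≤ Hol p) :
    Nat.card (thetaHom G hG).range = thetaCard p G := by
  have : ((thetaHom G hG).range : Set (Equiv.Perm (Heisenberg p))) =
      theta p '' (G : Set (Equiv.Perm (Heisenberg p))) := by
    ext π
    constructor
    · rintro ⟨g, rfl⟩
      exact ⟨g, g.2, rfl⟩
    · rintro ⟨g, hg, rfl⟩
      exact ⟨⟨g, hg⟩, rfl⟩
  rw [thetaCard, ← this]
  rfl

theorem card_heisenberg : Nat.card (Heisenberg p) = p ^ 3 := by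
  have e : Heisenberg p ≃ ZMod p × ZMod p × ZMod p :=
    ⟨fun g => (g.x, g.y, g.z), fun t => ⟨t.1, t.2.1, t.2.2⟩, fun _ => rfl, fun _ => rfl⟩
  rw [Nat.card_congr e, Nat.card_prod, Nat.card_prod, Nat.card_zmod]
  ring

/-- A determinant-one frame `e = (e₁, e₂)`, `d = (d₁, d₂)` of the plane `M₁ / Z(M₁)`. -/
structure Frame (p : ℕ) where
  e₁ : ZMod p
  e₂ : ZMod p
  d₁ : ZMod p
  d₂ : ZMod p
  det_eq : e₁ * d₂ - e₂ * d₁ = 1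

variable [Fact p.Prime]

/-- The coordinate along `e` of the image of `g` in `M₁ / Z(M₁)`. -/
def eCoord (F : Frame p) (g : Heisenberg p) : ZMod p := F.d₂ * g.x - F.d₁ * g.y

/-- The coordinate along `d` of the image of `g` in `M₁ / Z(M₁)`. -/
def dCoord (F : Frame p) (g : Heisenberg p) : ZMod p := F.e₁ * g.y - F.e₂ * g.x

/-- The symmetrized central coordinate. -/
def wCoord (g : Heisenberg p) : ZMod p := g.z - g.x * g.y / 2

/-- The element with given coordinates with respect to a frame. -/
def ofCoords (F : Frame p) (l m w : ZMod p) : Heisenberg p :=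
  ⟨l * F.e₁ + m * F.d₁, l * F.e₂ + m * F.d₂,
    w + (l * F.e₁ + m * F.d₁) * (l * F.e₂ + m * F.d₂) / 2⟩

@[simp] theorem eCoord_ofCoords (F : Frame p) (l m w : ZMod p) :
    eCoord F (ofCoords F l m w) = l := by
  simp only [eCoord, ofCoords]; linear_combination l * F.det_eq

@[simp] theorem dCoord_ofCoords (F : Frame p) (l m w : ZMod p) :
    dCoord F (ofCoords F l m w) = m := by
  simp only [dCoord, ofCoords]; linear_combination m * F.det_eq

@[simp] theorem wCoord_ofCoords (F : Frame p) (l m w : ZMod p) :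
    wCoord (ofCoords F l m w) = w := by
  simp only [wCoord, ofCoords]; ring

theorem ext_coords (F : Frame p) {g h : Heisenberg p} (hl : eCoord F g = eCoord F h)
    (hm : dCoord F g = dCoord F h) (hw : wCoord g = wCoord h) : g = h := by
  simp only [eCoord, dCoord, wCoord] at hl hm hw
  have hx : g.x = h.x := by
    linear_combination F.e₁ * hl + F.d₁ * hm - (g.x - h.x) * F.det_eq
  have hy : g.y = h.y := by
    linear_combination F.e₂ * hl + F.d₂ * hm - (g.y - h.y) * F.det_eq
  have hz : g.z = h.z := by
    rw [hx, hy] at hw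
    linear_combination hw
  exact Heisenberg.ext hx hy hz

@[simp] theorem eCoord_mul (F : Frame p) (g h : Heisenberg p) :
    eCoord F (g * h) = eCoord F g + eCoord F h := by
  simp only [eCoord, mul_x, mul_y]; ring

@[simp] theorem dCoord_mul (F : Frame p) (g h : Heisenberg p) :
    dCoord F (g * h) = dCoord F g + dCoord F h := by
  simp only [dCoord, mul_x, mul_y]; ring

@[simp] theorem eCoord_one (F : Frame p) : eCoord F 1 = 0 := by simp [eCoord]
@[simp] theorem dCoord_one (F : Frame p) : dCoord F 1 = 0 := by simp [dCoord]
@[simp] theorem wCoord_one : wCoord (1 : Heisenberg p) = 0 := by simp [wCoord]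

@[simp] theorem eCoord_inv (F : Frame p) (g : Heisenberg p) :
    eCoord F g⁻¹ = -eCoord F g := by
  simp only [eCoord, inv_x, inv_y]; ring

theorem wCoord_mul (h2 : (2 : ZMod p) ≠ 0) (F : Frame p) (g h : Heisenberg p) :
    wCoord (g * h) = wCoord g + wCoord h +
      (dCoord F g * eCoord F h - eCoord F g * dCoord F h) / 2 := by
  simp only [wCoord, eCoord, dCoord, mul_x, mul_y, mul_z]
  field_simp
  linear_combination (g.x * h.y - h.x * g.y) * F.det_eq

theorem natCast_ne_zero_of_lt {n : ℕ} (hn : n ≠ 0) (h : n < p) : (n : ZMod p) ≠ 0 := by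
  rw [Ne, ZMod.natCast_eq_zero_iff]
  exact fun hd => absurd (Nat.le_of_dvd (Nat.pos_of_ne_zero hn) hd) (by omega)

theorem two_ne_zero_zmod (h3 : 3 < p) : (2 : ZMod p) ≠ 0 := by
  exact_mod_cast natCast_ne_zero_of_lt (n := 2) (by norm_num) (by omega)

theorem three_ne_zero_zmod (h3 : 3 < p) : (3 : ZMod p) ≠ 0 := by
  exact_mod_cast natCast_ne_zero_of_lt (n := 3) (by norm_num) h3

theorem additive_zmod (f : ZMod p → ZMod p) (hf : ∀ s t, f (s + t) = f s + f t) (s : ZMod p) :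
    f s = s * f 1 := by
  have h := ZMod.map_smul (AddMonoidHom.mk' f hf) s 1
  simpa using h

/-- An additive function on `M₁` factors linearly through `M₁ / Z(M₁)`. -/
theorem additive_eq (h2 : (2 : ZMod p) ≠ 0) (F : Frame p) (f : Heisenberg p → ZMod p)
    (hf : ∀ g h, f (g * h) = f g + f h) (g : Heisenberg p) :
    f g = eCoord F g * f (ofCoords F 1 0 0) + dCoord F g * f (ofCoords F 0 1 0) := by
  have hw : ∀ w, f (ofCoords F 0 0 w) = 0 := by
    intro w
    have h : ofCoords F 0 w 0 * ofCoords F 1 0 0 =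
        ofCoords F 0 0 w * (ofCoords F 1 0 0 * ofCoords F 0 w 0) := by
      apply ext_coords F <;> simp [wCoord_mul h2 F]
      field_simp; ring
    have h' := congrArg f h
    simp only [hf] at h'
    linear_combination -h'
  have hl : ∀ l, f (ofCoords F l 0 0) = l * f (ofCoords F 1 0 0) := by
    refine additive_zmod (fun l => f (ofCoords F l 0 0)) fun s t => ?_
    rw [← hf]
    congr 1
    apply ext_coords F <;> simp [wCoord_mul h2 F]
  have hm : ∀ m, f (ofCoords F 0 m 0) = m * f (ofCoords F 0 1 0) := by
    refine additive_zmod (fun l => f (ofCoords F 0 l 0)) fun s t => ?_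
    rw [← hf]
    congr 1
    apply ext_coords F <;> simp [wCoord_mul h2 F]
  have hg : g = ofCoords F (eCoord F g) 0 0 * ofCoords F 0 (dCoord F g) 0 *
      ofCoords F 0 0 (wCoord g + eCoord F g * dCoord F g / 2) := by
    apply ext_coords F <;> simp [wCoord_mul h2 F]
    ring
  conv_lhs => rw [hg]
  rw [hf, hf, hl, hm, hw, add_zero]

/-- The parameters `(a, b, c)` of a one-parameter group of automorphisms fixing `d` and acting
trivially on `M₁ / ⟨d, Z(M₁)⟩`. -/
abbrev Params (p : ℕ) := ZMod p × ZMod p × ZMod p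

/-- The underlying function of the one-parameter group of automorphisms. -/
def shearFun (F : Frame p) (q : Params p) (s : ZMod p) (g : Heisenberg p) : Heisenberg p :=
  ofCoords F (eCoord F g) (dCoord F g + s * q.1 * eCoord F g)
    (wCoord g + s * (q.2.1 * eCoord F g + q.2.2 * dCoord F g) +
      s ^ 2 / 2 * q.1 * q.2.2 * eCoord F g)

theorem shearFun_shearFun (h2 : (2 : ZMod p) ≠ 0) (F : Frame p) (q : Params p)
    (s t : ZMod p) (g : Heisenberg p) :
    shearFun F q s (shearFun F q t g) = shearFun F q (s + t) g := by
  apply ext_coords F <;> simp [shearFun]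
  · ring
  · field_simp; ring

theorem shearFun_zero (F : Frame p) (q : Params p) (g : Heisenberg p) :
    shearFun F q 0 g = g := by
  apply ext_coords F <;> simp [shearFun]

theorem shearFun_mul (h2 : (2 : ZMod p) ≠ 0) (F : Frame p) (q : Params p)
    (s : ZMod p) (g h : Heisenberg p) :
    shearFun F q s (g * h) = shearFun F q s g * shearFun F q s h := by
  apply ext_coords F <;> simp [shearFun, wCoord_mul h2 F] <;> ring

/-- The one-parameter group of automorphisms of `M₁` attached to a frame and parameters. -/
def shear (h2 : (2 : ZMod p) ≠ 0) (F : Frame p) (q : Params p) (s : ZMod p) :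
    MulAut (Heisenberg p) where
  toFun := shearFun F q s
  invFun := shearFun F q (-s)
  left_inv g := by simp [shearFun_shearFun h2, shearFun_zero]
  right_inv g := by simp [shearFun_shearFun h2, shearFun_zero]
  map_mul' := shearFun_mul h2 F q s

section shear

variable (h2 : (2 : ZMod p) ≠ 0) (F : Frame p) (q : Params p)

theorem shear_apply (s : ZMod p) (g : Heisenberg p) : shear h2 F q s g = shearFun F q s g := rfl

@[simp] theorem eCoord_shear (s : ZMod p) (g : Heisenberg p) :
    eCoord F (shear h2 F q s g) = eCoord F g := by simp [shear_apply, shearFun]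

@[simp] theorem dCoord_shear (s : ZMod p) (g : Heisenberg p) :
    dCoord F (shear h2 F q s g) = dCoord F g + s * q.1 * eCoord F g := by
  simp [shear_apply, shearFun]

@[simp] theorem wCoord_shear (s : ZMod p) (g : Heisenberg p) :
    wCoord (shear h2 F q s g) = wCoord g + s * (q.2.1 * eCoord F g + q.2.2 * dCoord F g) +
      s ^ 2 / 2 * q.1 * q.2.2 * eCoord F g := by
  simp [shear_apply, shearFun]

theorem shear_add_apply (s t : ZMod p) (g : Heisenberg p) :
    shear h2 F q (s + t) g = shear h2 F q s (shear h2 F q t g) :=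
  (shearFun_shearFun h2 F q s t g).symm

theorem shear_zero : shear h2 F q 0 = 1 := by
  ext1 g
  exact shearFun_zero F q g

theorem shear_injective (hq : q ≠ 0) : Function.Injective (shear h2 F q) := by
  intro s t hst
  obtain ⟨a, b, c⟩ := q
  have he := DFunLike.congr_fun hst (ofCoords F 1 0 0)
  have hd := DFunLike.congr_fun hst (ofCoords F 0 1 0)
  have h1 := congrArg (dCoord F) he
  have h4 := congrArg wCoord he
  have h5 := congrArg wCoord hd
  simp only [dCoord_shear, wCoord_shear, eCoord_ofCoords, dCoord_ofCoords, wCoord_ofCoords]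
    at h1 h4 h5
  by_contra hne
  have hne' : s - t ≠ 0 := sub_ne_zero.mpr hne
  have ha : a = 0 := by
    apply (mul_eq_zero.mp (_ : (s - t) * a = 0)).resolve_left hne'
    linear_combination h1
  have hc : c = 0 := by
    apply (mul_eq_zero.mp (_ : (s - t) * c = 0)).resolve_left hne'
    linear_combination h5
  subst ha hc
  have hb : b = 0 := by
    apply (mul_eq_zero.mp (_ : (s - t) * b = 0)).resolve_left hne'
    linear_combination h4
  exact hq (by rw [hb]; rfl)

theorem shear_one_injective : Function.Injective fun q => shear h2 F q 1 := by
  rintro ⟨a, b, c⟩ ⟨a', b', c'⟩ h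
  have he := DFunLike.congr_fun h (ofCoords F 1 0 0)
  have hd := DFunLike.congr_fun h (ofCoords F 0 1 0)
  have h1 := congrArg (dCoord F) he
  have h4 := congrArg wCoord he
  have h5 := congrArg wCoord hd
  simp only [dCoord_shear, wCoord_shear, eCoord_ofCoords, dCoord_ofCoords, wCoord_ofCoords]
    at h1 h4 h5
  have ha : a = a' := by linear_combination h1
  have hc : c = c' := by linear_combination h5
  subst ha hc
  have hb : b = b' := by linear_combination h4
  rw [hb]

/-- The element `m ↦ g * shear (eCoord g) m` of the holomorph. -/
def twist (g : Heisenberg p) : Equiv.Perm (Heisenberg p) :=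
  Equiv.mulLeft g * MulAut.toPerm _ (shear h2 F q (eCoord F g))

@[simp] theorem twist_apply (g h : Heisenberg p) :
    twist h2 F q g h = g * shear h2 F q (eCoord F g) h := rfl

theorem twist_one_apply (g : Heisenberg p) : twist h2 F q g 1 = g := by simp

theorem twist_mul_twist (g h : Heisenberg p) :
    twist h2 F q g * twist h2 F q h = twist h2 F q (g * shear h2 F q (eCoord F g) h) := by
  ext1 k
  simp [shear_add_apply, mul_assoc]

/-- The regular subgroup of the holomorph attached to a frame and parameters. -/
def twistSubgroup : Subgroup (Equiv.Perm (Heisenberg p)) where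
  carrier := Set.range (twist h2 F q)
  mul_mem' := by
    rintro _ _ ⟨g, rfl⟩ ⟨h, rfl⟩
    exact ⟨_, (twist_mul_twist h2 F q g h).symm⟩
  one_mem' := ⟨1, by ext1 k; simp [shear_zero]⟩
  inv_mem' := by
    rintro _ ⟨g, rfl⟩
    refine ⟨shear h2 F q (-eCoord F g) g⁻¹, ?_⟩
    rw [eq_inv_iff_mul_eq_one]
    ext1 k
    simp only [Equiv.Perm.mul_apply, twist_apply, eCoord_shear, eCoord_inv, ← map_mul,
      inv_mul_cancel_left, Equiv.Perm.one_apply]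
    rw [← shear_add_apply, neg_add_cancel, shear_zero, MulAut.one_apply]

theorem mem_twistSubgroup {π : Equiv.Perm (Heisenberg p)} :
    π ∈ twistSubgroup h2 F q ↔ ∃ g, twist h2 F q g = π := Iff.rfl

theorem twistSubgroup_le_Hol : twistSubgroup h2 F q ≤ Hol p := by
  rintro _ ⟨g, rfl⟩
  exact mul_mem (Subgroup.mem_sup_left ⟨g, rfl⟩) (Subgroup.mem_sup_right ⟨_, rfl⟩)

theorem isRegularSub_twistSubgroup : IsRegularSub (twistSubgroup h2 F q) := by
  have key : ∀ π ∈ twistSubgroup h2 F q, ∀ x, π = twist h2 F q (π x) * (twist h2 F q x)⁻¹ := by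
    rintro _ ⟨g, rfl⟩ x
    rw [eq_mul_inv_iff_mul_eq, twist_mul_twist, twist_apply]
  intro x y
  refine ⟨twist h2 F q y * (twist h2 F q x)⁻¹, ⟨mul_mem ⟨y, rfl⟩ (inv_mem ⟨x, rfl⟩), ?_⟩, ?_⟩
  · have : (twist h2 F q x)⁻¹ x = 1 := by
      rw [Equiv.Perm.inv_eq_iff_eq, twist_one_apply]
    rw [Equiv.Perm.mul_apply, this, twist_one_apply]
  · rintro π ⟨hπ, rfl⟩
    exact key π hπ x

theorem theta_twist (g : Heisenberg p) :
    theta p (twist h2 F q g) = MulAut.toPerm _ (shear h2 F q (eCoord F g)) := by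
  rw [theta, twist_one_apply, twist, inv_mul_cancel_left]

theorem thetaCard_twistSubgroup (hq : q ≠ 0) : thetaCard p (twistSubgroup h2 F q) = p := by
  have hinj : Function.Injective fun s => MulAut.toPerm _ (shear h2 F q s) :=
    fun s t h => shear_injective h2 F q hq (MulEquiv.ext fun g => DFunLike.congr_fun h g)
  have : theta p '' (twistSubgroup h2 F q : Set (Equiv.Perm (Heisenberg p))) =
      Set.range fun s => MulAut.toPerm _ (shear h2 F q s) := by
    ext π
    constructor
    · rintro ⟨_, ⟨g, rfl⟩, rfl⟩
      exact ⟨eCoord F g, (theta_twist h2 F q g).symm⟩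
    · rintro ⟨s, rfl⟩
      exact ⟨_, ⟨ofCoords F s 0 0, rfl⟩, by simp [theta_twist]⟩
  rw [thetaCard, this, Nat.card_range_of_injective hinj, Nat.card_zmod]

/-- Coordinates in which `twistSubgroup` has a bilinear multiplication. -/
def straight (s r w : ZMod p) : Heisenberg p :=
  ofCoords F s (r + q.1 * s ^ 2 / 2)
    (w + q.2.1 * s ^ 2 / 2 + (q.1 * q.2.2 / 2 - q.1 / 4) * s ^ 3 / 3 + s * r / 2)

theorem twist_straight_mul (h3 : (3 : ZMod p) ≠ 0) (s r w s' r' w' : ZMod p) :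
    twist h2 F q (straight F q s r w) * twist h2 F q (straight F q s' r' w') =
      twist h2 F q (straight F q (s + s') (r + r') (w + w' + (q.2.2 - 1) * s * r')) := by
  have h4 : (4 : ZMod p) ≠ 0 := by
    rw [show (4 : ZMod p) = 2 * 2 by norm_num]
    exact mul_ne_zero h2 h2
  rw [twist_mul_twist]
  congr 1
  apply ext_coords F <;> simp [straight, wCoord_mul h2 F]
  · field_simp; ring
  · field_simp; ring

theorem exists_straight (g : Heisenberg p) : ∃ s r w, straight F q s r w = g := by
  refine ⟨eCoord F g, dCoord F g - q.1 * eCoord F g ^ 2 / 2,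
    wCoord g - (q.2.1 * eCoord F g ^ 2 / 2 +
      (q.1 * q.2.2 / 2 - q.1 / 4) * eCoord F g ^ 3 / 3 +
      eCoord F g * (dCoord F g - q.1 * eCoord F g ^ 2 / 2) / 2), ?_⟩
  apply ext_coords F <;> simp [straight]
  ring

theorem straight_inj {s r w s' r' w' : ZMod p}
    (h : straight F q s r w = straight F q s' r' w') : s = s' ∧ r = r' ∧ w = w' := by
  have hs := congrArg (eCoord F) h
  have hr := congrArg (dCoord F) h
  have hw := congrArg wCoord h
  simp only [straight, eCoord_ofCoords, dCoord_ofCoords, wCoord_ofCoords] at hs hr hw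
  subst hs
  have hr' : r = r' := by linear_combination hr
  subst hr'
  exact ⟨rfl, rfl, by linear_combination hw⟩

theorem twist_injective : Function.Injective (twist h2 F q) := fun g h hgh => by
  simpa using DFunLike.congr_fun hgh 1

theorem nonempty_mulEquiv_heisenberg (h3 : (3 : ZMod p) ≠ 0) (hc : q.2.2 ≠ 1) :
    Nonempty (twistSubgroup h2 F q ≃* Heisenberg p) := by
  have hk : q.2.2 - 1 ≠ 0 := sub_ne_zero.mpr hc
  let f : Heisenberg p →* Equiv.Perm (Heisenberg p) :=
    MonoidHom.mk' (fun g => twist h2 F q (straight F q g.y (g.x / (q.2.2 - 1)) g.z)) fun g h => by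
      rw [twist_straight_mul h2 F q h3]
      congr 2
      · simp [add_div]
      · simp only [mul_z]
        field_simp
  have hf : Function.Injective f := fun g h hgh => by
    obtain ⟨hy, hx, hz⟩ := straight_inj F q (twist_injective h2 F q hgh)
    exact Heisenberg.ext (by field_simp at hx; exact hx) hy hz
  have hr : f.range = twistSubgroup h2 F q := by
    ext π
    constructor
    · rintro ⟨g, rfl⟩
      exact ⟨_, rfl⟩
    · rintro ⟨g, rfl⟩
      obtain ⟨s, r, w, rfl⟩ := exists_straight F q g
      exact ⟨⟨(q.2.2 - 1) * r, s, w⟩, by simp [f, hk]⟩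
  rw [← hr]
  exact ⟨(MonoidHom.ofInjective hf).symm⟩

theorem nonempty_mulEquiv_multiplicative (h3 : (3 : ZMod p) ≠ 0) (hc : q.2.2 = 1) :
    Nonempty (twistSubgroup h2 F q ≃* Multiplicative (ZMod p × ZMod p × ZMod p)) := by
  let f : Multiplicative (ZMod p × ZMod p × ZMod p) →* Equiv.Perm (Heisenberg p) :=
    MonoidHom.mk' (fun g => twist h2 F q
      (straight F q g.toAdd.1 g.toAdd.2.1 g.toAdd.2.2)) fun g h => by
      rw [twist_straight_mul h2 F q h3, hc]
      simp
  have hf : Function.Injective f := fun g h hgh => by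
    obtain ⟨hx, hy, hz⟩ := straight_inj F q (twist_injective h2 F q hgh)
    exact Multiplicative.toAdd.injective (Prod.ext hx (Prod.ext hy hz))
  have hr : f.range = twistSubgroup h2 F q := by
    ext π
    constructor
    · rintro ⟨g, rfl⟩
      exact ⟨_, rfl⟩
    · rintro ⟨g, rfl⟩
      obtain ⟨s, r, w, rfl⟩ := exists_straight F q g
      exact ⟨Multiplicative.ofAdd (s, r, w), rfl⟩
  rw [← hr]
  exact ⟨(MonoidHom.ofInjective hf).symm⟩

end shear

theorem not_nonempty_mulEquiv (p : ℕ) [Fact p.Prime] {G : Type*} [Group G]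
    (h₁ : Nonempty (G ≃* Heisenberg p))
    (h₂ : Nonempty (G ≃* Multiplicative (ZMod p × ZMod p × ZMod p))) : False := by
  obtain ⟨e₁⟩ := h₁
  obtain ⟨e₂⟩ := h₂
  have h : (σ * τ : Heisenberg p) = τ * σ := by
    apply (e₁.symm.trans e₂).injective
    rw [map_mul, map_mul, mul_comm]
  simpa [σ, τ] using congrArg Heisenberg.z h

/-- A frame for each line `⟨d⟩` of the plane `M₁ / Z(M₁)`. -/
def frame : Option (ZMod p) → Frame p
  | none => ⟨1, 0, 0, 1, by ring⟩
  | some t => ⟨0, -1, 1, t, by ring⟩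

theorem frame_unique {i j : Option (ZMod p)}
    (h : ∀ g, eCoord (frame i) g = 0 → eCoord (frame j) g = 0) : i = j := by
  have h' := h (ofCoords (frame i) 0 1 0) (eCoord_ofCoords _ _ _ _)
  cases i <;> cases j <;> simp [frame, ofCoords, eCoord] at h' ⊢
  linear_combination -h'

theorem exists_frame {u v : ZMod p} (h : u ≠ 0 ∨ v ≠ 0) :
    ∃ i, ∀ g : Heisenberg p, eCoord (frame i) g = 0 ↔ g.x * u + g.y * v = 0 := by
  by_cases hv : v = 0
  · have hu : u ≠ 0 := h.resolve_right (not_not.mpr hv)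
    exact ⟨none, fun g => by simp [frame, eCoord, hv, hu]⟩
  · refine ⟨some (-u / v), fun g => ?_⟩
    have : eCoord (frame (some (-u / v))) g = -(g.x * u + g.y * v) / v := by
      simp only [frame, eCoord]
      field_simp
      ring
    rw [this, div_eq_zero_iff, or_iff_left hv, neg_eq_zero]

theorem twistSubgroup_inj (h2 : (2 : ZMod p) ≠ 0) {i j : Option (ZMod p)} {q q' : Params p}
    (hq' : q' ≠ 0)
    (h : twistSubgroup h2 (frame i) q = twistSubgroup h2 (frame j) q') : i = j ∧ q = q' := by
  have key : ∀ g, shear h2 (frame i) q (eCoord (frame i) g) =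
      shear h2 (frame j) q' (eCoord (frame j) g) := by
    intro g
    have hg : twist h2 (frame i) q g ∈ twistSubgroup h2 (frame j) q' := h ▸ ⟨g, rfl⟩
    obtain ⟨k, hk⟩ := hg
    have hkg : k = g := by simpa using DFunLike.congr_fun hk 1
    subst hkg
    ext1 m
    exact (mul_left_cancel (DFunLike.congr_fun hk m)).symm
  have hij : i = j := frame_unique fun g hg => by
    have hk := key g
    rw [hg, shear_zero, ← shear_zero h2 (frame j) q'] at hk
    exact (shear_injective h2 _ q' hq' hk).symm
  subst hij
  refine ⟨rfl, shear_one_injective h2 (frame i) ?_⟩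
  simpa using key (ofCoords (frame i) 1 0 0)

theorem card_eq_of_isRegularSub {X : Type*} {G : Subgroup (Equiv.Perm X)} (hG : IsRegularSub G)
    (x : X) : Nat.card G = Nat.card X := by
  refine Nat.card_eq_of_bijective (fun π : G => (π : Equiv.Perm X) x) ⟨fun π π' h => ?_, fun y => ?_⟩
  · exact Subtype.ext ((hG x (π'.1 x)).unique ⟨π.2, h⟩ ⟨π'.2, rfl⟩)
  · obtain ⟨π, ⟨hπ, hy⟩, -⟩ := hG x y
    exact ⟨⟨π, hπ⟩, hy⟩

theorem index_comap_leftMulHom {G : Subgroup (Equiv.Perm (Heisenberg p))} (hG : G ≤ Hol p)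
    (hr : IsRegularSub G) : (G.comap (leftMulHom p)).index = thetaCard p G := by
  have hker : Nat.card (G.comap (leftMulHom p)) = Nat.card (thetaHom G hG).ker := by
    have hmem : ∀ n : G.comap (leftMulHom p),
        (⟨leftMulHom p n, n.2⟩ : G) ∈ (thetaHom G hG).ker := fun n => by
      rw [MonoidHom.mem_ker]
      ext1 g
      change (leftMulHom p n 1)⁻¹ * leftMulHom p n g = g
      simp [leftMulHom_apply]
    refine Nat.card_eq_of_bijective (fun n => ⟨⟨leftMulHom p n, n.2⟩, hmem n⟩)
      ⟨fun m n h => ?_, ?_⟩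
    · have h' := congrArg (fun π => (π.1.1 : Equiv.Perm (Heisenberg p)) 1) h
      simpa [leftMulHom_apply] using h'
    · rintro ⟨⟨π, hπ⟩, hk⟩
      have h : leftMulHom p (π 1) = π := by
        ext1 g
        have hg : (π 1)⁻¹ * π g = g := DFunLike.congr_fun (MonoidHom.mem_ker.mp hk) g
        rw [leftMulHom_apply, ← eq_inv_mul_iff_mul_eq, hg]
      exact ⟨⟨π 1, by rw [Subgroup.mem_comap, h]; exact hπ⟩, Subtype.ext (Subtype.ext h)⟩
  have h1 := (G.comap (leftMulHom p)).card_mul_index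
  have h4 := (thetaHom G hG).ker.card_mul_index
  rw [Subgroup.index_ker, card_range_thetaHom, card_eq_of_isRegularSub hr 1, ← h1, hker] at h4
  have hpos : 0 < Nat.card (thetaHom G hG).ker := by
    rw [← hker]
    refine Nat.pos_of_ne_zero fun h => ?_
    rw [h, zero_mul, card_heisenberg] at h1
    exact pow_ne_zero 3 (Fact.out : p.Prime).ne_zero h1.symm
  exact (Nat.eq_of_mul_eq_mul_left hpos h4).symm

/-- A subgroup of index `p` of `M₁` is the kernel of one of the coordinates `eCoord (frame i)`. -/
theorem exists_frame_of_index (h2 : (2 : ZMod p) ≠ 0) {N : Subgroup (Heisenberg p)}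
    (hN : N.index = p) : ∃ i, ∀ g, g ∈ N ↔ eCoord (frame i) g = 0 := by
  have hp : p.Prime := Fact.out
  have hnormal : N.Normal := by
    apply Subgroup.normal_of_index_eq_minFac_card
    rw [hN, card_heisenberg, hp.pow_minFac (by norm_num)]
  have hcard : Nat.card (Heisenberg p ⧸ N) = p := hN
  let e : Heisenberg p ⧸ N ≃* Multiplicative (ZMod p) :=
    mulEquivOfPrimeCardEq hcard (by simp)
  let f : Heisenberg p → ZMod p := fun g => (e (QuotientGroup.mk g)).toAdd
  have hf : ∀ g h, f (g * h) = f g + f h := fun g h => by simp [f]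
  have hfN : ∀ g, g ∈ N ↔ f g = 0 := fun g => by simp [f]
  set u := f (ofCoords (frame none) 1 0 0)
  set v := f (ofCoords (frame none) 0 1 0)
  have hfg : ∀ g, f g = g.x * u + g.y * v := fun g => by
    rw [additive_eq h2 (frame none) f hf]
    simp [frame, eCoord, dCoord, u, v]
  have huv : u ≠ 0 ∨ v ≠ 0 := by
    by_contra! h
    have : N = ⊤ := eq_top_iff.mpr fun g _ => by
      rw [hfN, hfg, h.1, h.2]; ring
    rw [this, Subgroup.index_top] at hN
    exact hp.one_lt.ne hN
  obtain ⟨i, hi⟩ := exists_frame huv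
  exact ⟨i, fun g => by rw [hfN, hfg, hi]⟩

/-- An automorphism of order dividing `p` that preserves the kernel of `eCoord F` is a shear. -/
theorem exists_shear (h2 : (2 : ZMod p) ≠ 0) (F : Frame p) {α : Equiv.Perm (Heisenberg p)}
    (hmul : ∀ g h, α (g * h) = α g * α h) (hpow : α ^ p = 1)
    (hα : ∀ g, eCoord F g = 0 → eCoord F (α g) = 0) : ∃ q, ⇑α = shear h2 F q 1 := by
  have hl : ∀ g, eCoord F (α g) = eCoord F g * eCoord F (α (ofCoords F 1 0 0)) := fun g => by
    have h := additive_eq h2 F (fun g => eCoord F (α g)) (fun g h => by simp [hmul]) g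
    simpa [hα (ofCoords F 0 1 0)] using h
  have hl_pow : ∀ n : ℕ, ∀ g, eCoord F ((α ^ n) g) =
      eCoord F g * eCoord F (α (ofCoords F 1 0 0)) ^ n := by
    intro n
    induction n with
    | zero => simp
    | succ n ih => intro g; rw [pow_succ', Equiv.Perm.mul_apply, hl, ih]; ring
  have hl1 : eCoord F (α (ofCoords F 1 0 0)) = 1 := by
    have h := hl_pow p (ofCoords F 1 0 0)
    rw [hpow, ZMod.pow_card] at h
    simpa using h.symm
  have hl' : ∀ g, eCoord F (α g) = eCoord F g := fun g => by rw [hl, hl1, mul_one]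
  have hm : ∀ g, dCoord F (α g) = eCoord F g * dCoord F (α (ofCoords F 1 0 0)) +
      dCoord F g * dCoord F (α (ofCoords F 0 1 0)) :=
    additive_eq h2 F (fun g => dCoord F (α g)) (fun g h => by simp [hmul])
  have hm_pow : ∀ n : ℕ, eCoord F ((α ^ n) (ofCoords F 0 1 0)) = 0 ∧
      dCoord F ((α ^ n) (ofCoords F 0 1 0)) = dCoord F (α (ofCoords F 0 1 0)) ^ n := by
    intro n
    induction n with
    | zero => simp
    | succ n ih =>
      rw [pow_succ', Equiv.Perm.mul_apply, hl', hm, ih.1, ih.2]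
      exact ⟨rfl, by ring⟩
  have hm1 : dCoord F (α (ofCoords F 0 1 0)) = 1 := by
    have h := (hm_pow p).2
    rw [hpow, ZMod.pow_card] at h
    simpa using h.symm
  simp only [hm1, mul_one] at hm
  set a := dCoord F (α (ofCoords F 1 0 0))
  have hw := additive_eq h2 F (fun g => wCoord (α g) - wCoord g) fun g h => by
    simp only [hmul, wCoord_mul h2 F, hl', hm]; ring
  set b := wCoord (α (ofCoords F 1 0 0)) - wCoord (ofCoords F 1 0 0)
  set c := wCoord (α (ofCoords F 0 1 0)) - wCoord (ofCoords F 0 1 0)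
  refine ⟨(a, b - a * c / 2, c), funext fun g => ext_coords F ?_ ?_ ?_⟩
  · rw [hl', eCoord_shear]
  · rw [hm, dCoord_shear]; ring
  · rw [wCoord_shear]; linear_combination hw g

theorem exists_eq_twistSubgroup (h2 : (2 : ZMod p) ≠ 0)
    {G : Subgroup (Equiv.Perm (Heisenberg p))} (hG : G ≤ Hol p) (hr : IsRegularSub G)
    (hc : thetaCard p G = p) : ∃ i q, q ≠ 0 ∧ twistSubgroup h2 (frame i) q = G := by
  obtain ⟨i, hi⟩ := exists_frame_of_index h2 ((index_comap_leftMulHom hG hr).trans hc)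
  simp only [Subgroup.mem_comap] at hi
  set F := frame i
  set e := ofCoords F 1 0 0 with he
  obtain ⟨π, ⟨hπ, hπe⟩, -⟩ := hr 1 e
  have hheap := Hol_le_heapAut (hG hπ)
  have hpow : theta p π ^ p = 1 := by
    have h := pow_card_eq_one' (x := (thetaHom G hG).rangeRestrict ⟨π, hπ⟩)
    rw [card_range_thetaHom, hc] at h
    exact congrArg Subtype.val h
  obtain ⟨q, hq⟩ := exists_shear h2 F (theta_map_mul hheap) hpow fun g hg => by
    have hconj : π * leftMulHom p g * π⁻¹ = leftMulHom p (π g * (π 1)⁻¹) := by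
      ext1 k
      have h := hheap g 1 (π⁻¹ k)
      rw [inv_one, mul_one, show π (π⁻¹ k) = k from π.apply_symm_apply k] at h
      exact h
    have h := (hi (π g * (π 1)⁻¹)).mp
      (hconj ▸ G.mul_mem (G.mul_mem hπ ((hi g).mpr hg)) (G.inv_mem hπ))
    rw [theta_apply, eCoord_mul, eCoord_inv]
    rw [eCoord_mul, eCoord_inv] at h
    linear_combination h
  have hπ_eq : ∀ g, π g = e * shear h2 F q 1 g := fun g => by
    rw [← hq, theta_apply, hπe, mul_inv_cancel_left]
  have hpowers : ∀ n : ℕ, ∀ g, eCoord F g = n →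
      Equiv.mulLeft g * MulAut.toPerm _ (shear h2 F q n) ∈ G := by
    intro n
    induction n with
    | zero =>
      intro g hg
      rw [Nat.cast_zero] at hg ⊢
      rw [shear_zero, map_one, mul_one]
      exact (hi g).mpr hg
    | succ n ih =>
      intro g hg
      have h := G.mul_mem (ih (g * (shear h2 F q n e)⁻¹) (by simp [hg, he])) hπ
      convert h using 1
      ext1 k
      simp only [Equiv.Perm.mul_apply, Equiv.coe_mulLeft, toPerm_apply, hπ_eq, map_mul,
        Nat.cast_succ, shear_add_apply]
      group
  have hle : twistSubgroup h2 F q ≤ G := by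
    rintro _ ⟨g, rfl⟩
    have h := hpowers (eCoord F g).val g (by simp)
    rwa [ZMod.natCast_zmod_val] at h
  refine ⟨i, q, ?_, le_antisymm hle fun π' hπ' => ?_⟩
  · rintro rfl
    have h : leftMulHom p e = π := by
      ext1 g
      rw [hπ_eq, leftMulHom_apply]
      congr 1
      apply ext_coords F <;> simp
    have h' := (hi e).mp (h ▸ hπ)
    rw [he, eCoord_ofCoords] at h'
    exact one_ne_zero h'
  · have h : twist h2 F q (π' 1) = π' :=
      (hr 1 (π' 1)).unique ⟨hle ⟨_, rfl⟩, twist_one_apply _ _ _ _⟩ ⟨hπ', rfl⟩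
    exact ⟨_, h⟩

theorem condM1_iff (h3 : 3 < p) (G : Subgroup (Equiv.Perm (Heisenberg p))) :
    condM1 p p G ↔ ∃ i q, (q ≠ 0 ∧ q.2.2 ≠ 1) ∧
      twistSubgroup (two_ne_zero_zmod h3) (frame i) q = G := by
  constructor
  · rintro ⟨hG, hr, hc, hM⟩
    obtain ⟨i, q, hq, rfl⟩ := exists_eq_twistSubgroup (two_ne_zero_zmod h3) hG hr hc
    exact ⟨i, q, ⟨hq, fun h => not_nonempty_mulEquiv p hM
      (nonempty_mulEquiv_multiplicative _ _ _ (three_ne_zero_zmod h3) h)⟩, rfl⟩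
  · rintro ⟨i, q, ⟨hq, hc⟩, rfl⟩
    exact ⟨twistSubgroup_le_Hol _ _ _, isRegularSub_twistSubgroup _ _ _,
      thetaCard_twistSubgroup _ _ _ hq,
      nonempty_mulEquiv_heisenberg _ _ _ (three_ne_zero_zmod h3) hc⟩

theorem condEA_iff (h3 : 3 < p) (G : Subgroup (Equiv.Perm (Heisenberg p))) :
    condEA p p G ↔ ∃ i q, (q ≠ 0 ∧ q.2.2 = 1) ∧
      twistSubgroup (two_ne_zero_zmod h3) (frame i) q = G := by
  constructor
  · rintro ⟨hG, hr, hc, hM⟩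
    obtain ⟨i, q, hq, rfl⟩ := exists_eq_twistSubgroup (two_ne_zero_zmod h3) hG hr hc
    exact ⟨i, q, ⟨hq, by_contra fun h => not_nonempty_mulEquiv p
      (nonempty_mulEquiv_heisenberg _ _ _ (three_ne_zero_zmod h3) h) hM⟩, rfl⟩
  · rintro ⟨i, q, ⟨hq, hc⟩, rfl⟩
    exact ⟨twistSubgroup_le_Hol _ _ _, isRegularSub_twistSubgroup _ _ _,
      thetaCard_twistSubgroup _ _ _ hq,
      nonempty_mulEquiv_multiplicative _ _ _ (three_ne_zero_zmod h3) hc⟩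

theorem card_subtype_twistSubgroup (h2 : (2 : ZMod p) ≠ 0) {P : Params p → Prop}
    {C : Subgroup (Equiv.Perm (Heisenberg p)) → Prop}
    (hC : ∀ G, C G ↔ ∃ i q, (q ≠ 0 ∧ P q) ∧ twistSubgroup h2 (frame i) q = G) :
    Nat.card {G // C G} = (p + 1) * Nat.card {q : Params p // q ≠ 0 ∧ P q} := by
  have hcard : Nat.card (Option (ZMod p)) = p + 1 := by
    rw [Finite.card_option, Nat.card_zmod]
  rw [← hcard, ← Nat.card_prod]
  symm
  refine Nat.card_eq_of_bijective (fun x : Option (ZMod p) × {q : Params p // q ≠ 0 ∧ P q} =>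
    (⟨twistSubgroup h2 (frame x.1) x.2, (hC _).mpr ⟨_, _, x.2.2, rfl⟩⟩ : {G // C G}))
    ⟨fun x y h => ?_, ?_⟩
  · obtain ⟨hi, hq⟩ := twistSubgroup_inj h2 y.2.2.1 (congrArg Subtype.val h)
    exact Prod.ext hi (Subtype.ext hq)
  · rintro ⟨G, hG⟩
    obtain ⟨i, q, hq, rfl⟩ := (hC G).mp hG
    exact ⟨(i, ⟨q, hq⟩), rfl⟩

theorem card_params_eq_one : Nat.card {q : Params p // q ≠ 0 ∧ q.2.2 = 1} = p ^ 2 := by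
  have e : {q : Params p // q ≠ 0 ∧ q.2.2 = 1} ≃ ZMod p × ZMod p :=
    { toFun := fun q => (q.1.1, q.1.2.1)
      invFun := fun t => ⟨(t.1, t.2, 1), fun h => one_ne_zero (congrArg (fun q => q.2.2) h), rfl⟩
      left_inv := by
        rintro ⟨⟨a, b, c⟩, h, rfl : c = 1⟩
        rfl
      right_inv := fun _ => rfl }
  rw [Nat.card_congr e, Nat.card_prod, Nat.card_zmod]
  ring

theorem card_params_ne_one :
    Nat.card {q : Params p // q ≠ 0 ∧ q.2.2 ≠ 1} = p ^ 3 - p ^ 2 - 1 := by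
  classical
  have h1 := card_params_eq_one (p := p)
  rw [Nat.card_eq_fintype_card, Fintype.card_subtype] at h1 ⊢
  have hne : Finset.card {q : Params p | q ≠ 0} = p ^ 3 - 1 := by
    rw [Finset.filter_ne', Finset.card_erase_of_mem (Finset.mem_univ _), Finset.card_univ]
    simp only [Fintype.card_prod, ZMod.card]
    ring_nf
  have hsplit := Finset.card_filter_add_card_filter_not
    (s := ({q : Params p | q ≠ 0} : Finset (Params p))) (fun q => q.2.2 = 1)
  rw [Finset.filter_filter, Finset.filter_filter, h1, hne] at hsplit
  have : Finset.card {q : Params p | q ≠ 0 ∧ q.2.2 ≠ 1} =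
    Finset.card {q : Params p | q ≠ 0 ∧ ¬ q.2.2 = 1} := rfl
  omega

end Heisenberg

/-- There are `(p³ − p² − 1)(p + 1)` regular subgroups of `Hol(M₁)`
isomorphic to `M₁` with `|Θ(G)| = p`, and `(p + 1)p²` elementary abelian ones. -/
theorem count_regular_subgroups_theta_p (p : ℕ) [Fact p.Prime] (h3 : 3 < p) :
    Nat.card {G : Subgroup (Equiv.Perm (Heisenberg p)) // condM1 p p G} =
      (p ^ 3 - p ^ 2 - 1) * (p + 1) ∧
    Nat.card {G : Subgroup (Equiv.Perm (Heisenberg p)) // condEA p p G} =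
      (p + 1) * p ^ 2 := by
  rw [card_subtype_twistSubgroup (two_ne_zero_zmod h3) (condM1_iff h3),
    card_subtype_twistSubgroup (two_ne_zero_zmod h3) (condEA_iff h3),
    card_params_ne_one, card_params_eq_one]
  exact ⟨mul_comm _ _, rfl⟩
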